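/- For every p with 1 < p < ∞ and every m ≥ 1, there is no injective map x : {0,1,2,3} → ℝ^m such that the metric d(i,j) = ‖x_i − x_j‖_p (the ℓ_p-distance on ℝ^m) is a SIG-metric for the star graph S(3). In particular, for every p ∈ (1,∞) there exists a connected simple graph admitting no ℓ_p SIG-embedding into any Euclidean space. -/

import Mathlib

open Finset

/-- The ℓ_p distance on `ℝ^m`: `d_p(x,y) = (∑ |x_k − y_k|^p)^{1/p}`. -/
noncomputable def lpDist (p : ℝ) {m : ℕ} (x y : Fin m → ℝ) : ℝ :=
  (∑ k, |x k - y k| ^ p) ^ (1 / p)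

/-- The star graph `S(3)` on vertex set `{0, 1, 2, 3}`, with edges exactly `{0, i}`
for `i = 1, 2, 3`. -/
def starThree : SimpleGraph (Fin 4) :=
  SimpleGraph.fromRel (fun i _ => i = 0)

/-- The radius of influence `r_i = min_{j ≠ i} d(i,j)`. -/
noncomputable def sigRadius {α : Type*} (d : α → α → ℝ) (i : α) : ℝ :=
  sInf {x | ∃ j, j ≠ i ∧ x = d i j}

/-- `d` is a `SIG`-metric for the graph `G`. -/
def IsSIGMetric {α : Type*} (G : SimpleGraph α) (d : α → α → ℝ) : Prop :=
  ∀ i j, i ≠ j →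
    (G.Adj i j → d i j < sigRadius d i + sigRadius d j) ∧
    (¬ G.Adj i j → sigRadius d i + sigRadius d j ≤ d i j)

theorem abs_add_div_two_rpow_lt {p : ℝ} (hp : 1 < p) {a b : ℝ} (hab : a ≠ b) :
    |(a + b) / 2| ^ p < (|a| ^ p + |b| ^ p) / 2 := by
  by_cases habs : |a| = |b|
  · rcases abs_eq_abs.1 habs with h | h
    · exact absurd h hab
    · have hb : b ≠ 0 := by
        rintro rfl
        simp [h] at hab
      have : 0 < |b| ^ p := Real.rpow_pos_of_pos (abs_pos.2 hb) p
      rw [habs, h, neg_add_cancel, zero_div, abs_zero, Real.zero_rpow (by linarith)]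
      linarith
  · have h := (strictConvexOn_rpow hp).2 (abs_nonneg a) (abs_nonneg b) habs
      one_half_pos one_half_pos (add_halves 1)
    simp only [smul_eq_mul] at h
    have h' : |(a + b) / 2| ≤ 1 / 2 * |a| + 1 / 2 * |b| := by
      rw [abs_div, abs_two]
      linarith [abs_add_le a b]
    linarith [Real.rpow_le_rpow (abs_nonneg _) h' (by linarith : 0 ≤ p)]

theorem abs_add_div_two_rpow_le {p : ℝ} (hp : 1 < p) (a b : ℝ) :
    |(a + b) / 2| ^ p ≤ (|a| ^ p + |b| ^ p) / 2 := by
  rcases eq_or_ne a b with rfl | hab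
  · rw [add_self_div_two, add_self_div_two]
  · exact (abs_add_div_two_rpow_lt hp hab).le

theorem PiLp.strictConvexSpace_real {ι : Type*} [Fintype ι] {q : ENNReal} [Fact (1 ≤ q)]
    (hq : 1 < q.toReal) : StrictConvexSpace ℝ (PiLp q fun _ : ι => ℝ) := by
  have hq0 : 0 < q.toReal := by linarith
  have norm_rpow : ∀ z : PiLp q fun _ : ι => ℝ, ‖z‖ ^ q.toReal = ∑ k, |z k| ^ q.toReal := by
    intro z
    rw [PiLp.norm_eq_sum hq0, ← Real.rpow_mul (by positivity), one_div_mul_cancel hq0.ne',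
      Real.rpow_one]
    simp only [Real.norm_eq_abs]
  refine .of_norm_combo_ne_one fun x y hx hy hxy =>
    ⟨1 / 2, 1 / 2, one_half_pos.le, one_half_pos.le, add_halves 1, fun hz => ?_⟩
  have hx' := norm_rpow x
  have hy' := norm_rpow y
  have hz' := norm_rpow ((1 / 2 : ℝ) • x + (1 / 2 : ℝ) • y)
  rw [hx, Real.one_rpow] at hx'
  rw [hy, Real.one_rpow] at hy'
  rw [hz, Real.one_rpow] at hz'
  have coord : ∀ k, ((1 / 2 : ℝ) • x + (1 / 2 : ℝ) • y) k = (x k + y k) / 2 := by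
    intro k
    simp only [PiLp.add_apply, PiLp.smul_apply, smul_eq_mul]
    ring
  simp only [coord] at hz'
  obtain ⟨k, hk⟩ : ∃ k, x k ≠ y k := by
    by_contra! h
    exact hxy (PiLp.ext h)
  have hlt := Finset.sum_lt_sum (fun i _ => abs_add_div_two_rpow_le hq (x i) (y i))
    ⟨k, Finset.mem_univ k, abs_add_div_two_rpow_lt hq hk⟩
  rw [← hz', ← Finset.sum_div, Finset.sum_add_distrib, ← hx', ← hy'] at hlt
  norm_num at hlt

theorem lpDist_eq_dist_toLp {p : ℝ} (hp : 1 < p) {m : ℕ} (x y : Fin m → ℝ) :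
    lpDist p x y = dist (WithLp.toLp (ENNReal.ofReal p) x) (WithLp.toLp (ENNReal.ofReal p) y) := by
  have h : (ENNReal.ofReal p).toReal = p := ENNReal.toReal_ofReal (by linarith)
  rw [PiLp.dist_eq_sum (by linarith), h]
  rfl

theorem exists_sigRadius_eq {α : Type*} [Finite α] [Nontrivial α] (d : α → α → ℝ) (i : α) :
    ∃ j, j ≠ i ∧ sigRadius d i = d i j := by
  have hne : {x | ∃ j, j ≠ i ∧ x = d i j}.Nonempty :=
    let ⟨j, hj⟩ := exists_ne i
    ⟨_, j, hj, rfl⟩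
  have hfin : {x | ∃ j, j ≠ i ∧ x = d i j}.Finite :=
    (Set.finite_range (d i)).subset fun _ ⟨j, _, hj⟩ => ⟨j, hj.symm⟩
  exact hne.csInf_mem hfin

theorem starThree_adj {i j : Fin 4} : starThree.Adj i j ↔ i ≠ j ∧ (i = 0 ∨ j = 0) := by
  simp [starThree]

theorem starThree_connected : starThree.Connected := by
  have h : ∀ i, starThree.Reachable 0 i := fun i => by
    rcases eq_or_ne 0 i with rfl | hi
    · exact .rfl
    · exact (starThree_adj.2 ⟨hi, .inl rfl⟩).reachable
  exact ⟨fun i j => (h i).symm.trans (h j)⟩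

/-- In a strictly convex space the leaves of a `SIG`-embedding of `S(3)` would lie in three
pairwise opposite directions as seen from the centre. -/
theorem not_isSIGMetric_starThree_of_strictConvexSpace {E : Type*} [NormedAddCommGroup E]
    [NormedSpace ℝ E] [StrictConvexSpace ℝ E] {x : Fin 4 → E} (hx : Function.Injective x) :
    ¬ IsSIGMetric starThree fun i j => dist (x i) (x j) := by
  intro h
  set d : Fin 4 → Fin 4 → ℝ := fun i j => dist (x i) (x j)
  have radius_pos : ∀ i, 0 < sigRadius d i := fun i => by
    obtain ⟨j, hj, hr⟩ := exists_sigRadius_eq d i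
    rw [hr]
    exact dist_pos.2 (hx.ne hj.symm)
  have leaf_separated : ∀ i j, i ≠ 0 → j ≠ 0 → i ≠ j → sigRadius d i + sigRadius d j ≤ d i j :=
    fun i j hi hj hij => (h i j hij).2 (by simp [starThree_adj, hi, hj])
  have leaf_radius : ∀ i, i ≠ 0 → sigRadius d i = ‖x i - x 0‖ := fun i hi => by
    obtain ⟨j, hj, hr⟩ := exists_sigRadius_eq d i
    rcases eq_or_ne j 0 with rfl | hj0
    · rw [hr, ← dist_eq_norm]
    · linarith [leaf_separated i j hi hj0 hj.symm, radius_pos j]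
  have opposite : ∀ i j, i ≠ 0 → j ≠ 0 → i ≠ j → SameRay ℝ (x i - x 0) (-(x j - x 0)) := by
    intro i j hi hj hij
    rw [sameRay_iff_norm_add]
    refine le_antisymm (norm_add_le _ _) ?_
    rw [norm_neg, ← leaf_radius i hi, ← leaf_radius j hj, ← sub_eq_add_neg, sub_sub_sub_cancel_right,
      ← dist_eq_norm]
    exact leaf_separated i j hi hj hij
  have ne_zero : ∀ i, i ≠ 0 → x i - x 0 ≠ 0 := fun i hi => sub_ne_zero.2 (hx.ne hi)
  have h12 := opposite 1 2 (by decide) (by decide) (by decide)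
  have h13 := opposite 1 3 (by decide) (by decide) (by decide)
  have h23 := opposite 2 3 (by decide) (by decide) (by decide)
  have h23' : SameRay ℝ (-(x 2 - x 0)) (x 3 - x 0) := by simpa using h23.neg
  have h13' : SameRay ℝ (x 1 - x 0) (x 3 - x 0) :=
    h12.trans h23' fun h0 => absurd (neg_eq_zero.1 h0) (ne_zero 2 (by decide))
  have h33 : SameRay ℝ (x 3 - x 0) (-(x 3 - x 0)) :=
    h13'.symm.trans h13 fun h0 => absurd h0 (ne_zero 1 (by decide))
  exact ne_zero 3 (by decide) (eq_zero_of_sameRay_self_neg h33)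

theorem not_isSIGMetric_starThree_lpDist {p : ℝ} (hp : 1 < p) {m : ℕ} {x : Fin 4 → (Fin m → ℝ)}
    (hx : Function.Injective x) : ¬ IsSIGMetric starThree fun i j => lpDist p (x i) (x j) := by
  have : Fact (1 ≤ ENNReal.ofReal p) := ⟨ENNReal.one_le_ofReal.2 hp.le⟩
  have : StrictConvexSpace ℝ (PiLp (ENNReal.ofReal p) fun _ : Fin m => ℝ) :=
    PiLp.strictConvexSpace_real (by rwa [ENNReal.toReal_ofReal (by linarith)])
  simp only [lpDist_eq_dist_toLp hp]
  exact not_isSIGMetric_starThree_of_strictConvexSpace ((WithLp.toLp_injective _).comp hx)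

/-- For every `p` with `1 < p < ∞` and every `m ≥ 1`, there is no
injective map `x : {0,1,2,3} → ℝ^m` whose ℓ_p distance matrix is a `SIG`-metric for
the star graph `S(3)`.  In particular, for every such `p` there exists a connected
simple graph admitting no ℓ_p `SIG`-embedding into any Euclidean space. -/
theorem no_lp_sig_embedding_of_starThree :
    (∀ p : ℝ, 1 < p → ∀ m : ℕ, 1 ≤ m →
      ¬ ∃ x : Fin 4 → (Fin m → ℝ), Function.Injective x ∧
          IsSIGMetric starThree (fun i j => lpDist p (x i) (x j))) ∧
    (∀ p : ℝ, 1 < p → ∃ (N : ℕ) (G : SimpleGraph (Fin N)), G.Connected ∧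
      ∀ m : ℕ, 1 ≤ m →
        ¬ ∃ x : Fin N → (Fin m → ℝ), Function.Injective x ∧
            IsSIGMetric G (fun i j => lpDist p (x i) (x j))) := by
  exact ⟨fun p hp m _ ⟨_, hx, h⟩ => not_isSIGMetric_starThree_lpDist hp hx h,
    fun p hp => ⟨4, starThree, starThree_connected,
      fun m _ ⟨_, hx, h⟩ => not_isSIGMetric_starThree_lpDist hp hx h⟩⟩
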